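/- Let A be a Q(q)-algebra, B_i, B_j ∈ A, Z central, and suppose the a_{ij} = −1 relation B_i² B_j − [2]_q B_i B_j B_i + B_j B_i² = q Z B_j holds. Then for either parity p̄ and n = 2 the minimal-degree relation with B_j replaced by B_j² need not follow formally; however, if additionally ∑_{r+s=3} (−1)^r B^{(r)}_{i,p̄} B_j² B^{(s)}_{i,p̄} = 0 holds for both parities p̄ (the n = 2, a_{ij} = −1 minimal ıSerre–Lusztig relation), then ∑_{r+s=5} (−1)^r B^{(r)}_{i,p̄} B_j² B^{(s)}_{i,p̄} = 0 for both parities p̄. -/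

import Mathlib

noncomputable section

abbrev K : Type := RatFunc ℚ

/-- The indeterminate `q` in `ℚ(q)`. -/
def qq : K := RatFunc.X

/-- Balanced quantum integer at base `x`. -/
def qintx (x : K) (m : ℤ) : K := (x ^ m - x ^ (-m)) / (x - x⁻¹)

/-- Balanced quantum integer `[m]_q`. -/
def qint (m : ℤ) : K := qintx qq m

/-- Quantum factorial at base `x`. -/
def qfactx (x : K) (m : ℕ) : K := ∏ j ∈ Finset.range m, qintx x ((j : ℤ) + 1)

/-- Quantum factorial `[m]_q!`. -/
def qfact (m : ℕ) : K := qfactx qq m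

/-- Gaussian binomial coefficient at base `x` (zero when `r > m`). -/
def qbinomx (x : K) (m r : ℕ) : K :=
  if r ≤ m then qfactx x m / (qfactx x r * qfactx x (m - r)) else 0

/-- Gaussian binomial coefficient. -/
def qbinom (m r : ℕ) : K := qbinomx qq m r

/-- The ı-divided powers `B^{(m)}_{p̄}` of `B` with central parameter `Z`,
given by the closed product formulas of the paper. -/
def iDP {A : Type*} [Ring A] [Algebra K A] (B Z : A) (p : ZMod 2) (m : ℕ) : A :=
  (qfact m)⁻¹ •
    ((if m % 2 = 1 then B else 1) *
      ((List.range (m / 2)).map (fun j =>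
        B ^ 2 -
          ((qint (if p = 1 then 2 * (j : ℤ) + 1
                  else if m % 2 = 1 then 2 * (j : ℤ) + 2 else 2 * (j : ℤ))) ^ 2 * qq) • Z)).prod)

/-- The usual divided power `x^{(k)} = x^k/[k]_q!`. -/
def dp {A : Type*} [Ring A] [Algebra K A] (x : A) (k : ℕ) : A := (qfact k)⁻¹ • x ^ k

theorem qq_ne_zero : qq ≠ 0 := RatFunc.X_ne_zero

theorem qq_pow_ne_one {n : ℕ} (hn : n ≠ 0) : qq ^ n ≠ 1 := by
  intro h
  have h' : algebraMap (Polynomial ℚ) K (Polynomial.X ^ n) = algebraMap (Polynomial ℚ) K 1 := by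
    rw [map_pow, RatFunc.algebraMap_X, map_one]
    exact h
  have hdeg := congrArg Polynomial.natDegree (RatFunc.algebraMap_injective ℚ h')
  rw [Polynomial.natDegree_X_pow, Polynomial.natDegree_one] at hdeg
  exact hn hdeg

theorem qq_sub_inv_ne_zero : qq - qq⁻¹ ≠ 0 := by
  intro h
  apply qq_pow_ne_one two_ne_zero
  have hq := qq_ne_zero
  field_simp at h
  linear_combination h

theorem qint_natCast_ne_zero {n : ℕ} (hn : n ≠ 0) : qint n ≠ 0 := by
  have hq := qq_ne_zero
  refine div_ne_zero (fun h => qq_pow_ne_one (mul_ne_zero two_ne_zero hn) ?_) qq_sub_inv_ne_zero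
  rw [zpow_neg, zpow_natCast] at h
  field_simp at h
  rw [mul_comm, pow_mul]
  linear_combination h

theorem qint_zero : qint 0 = 0 := by simp [qint, qintx]

theorem qint_one : qint 1 = 1 := by
  simpa [qint, qintx] using div_self qq_sub_inv_ne_zero

/-- The three-term recursion of the quantum integers. -/
theorem qint_add_two (m : ℤ) : qint (m + 2) = qint 2 * qint (m + 1) - qint m := by
  have hq := qq_ne_zero
  have hd := qq_sub_inv_ne_zero
  have h2 : qint 2 = qq + qq⁻¹ := by
    rw [qint, qintx, div_eq_iff hd, zpow_neg]
    norm_cast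
    field_simp
    ring
  rw [h2]
  simp only [qint, qintx]
  rw [mul_div_assoc', ← sub_div]
  congr 1
  simp only [neg_add, zpow_add₀ hq, zpow_neg, zpow_ofNat]
  field_simp
  ring

theorem qint_three : qint 3 = qint 2 ^ 2 - 1 := by
  have h := qint_add_two 1
  norm_num [qint_one] at h
  rw [h]; ring

theorem qint_four : qint 4 = qint 2 ^ 3 - 2 * qint 2 := by
  have h := qint_add_two 2
  norm_num [qint_three] at h
  rw [h]; ring

theorem qint_five : qint 5 = qint 2 ^ 4 - 3 * qint 2 ^ 2 + 1 := by
  have h := qint_add_two 3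
  norm_num [qint_three, qint_four] at h
  rw [h]; ring

theorem qfact_succ (m : ℕ) : qfact (m + 1) = qfact m * qint (m + 1) :=
  Finset.prod_range_succ _ _

theorem qfact_zero : qfact 0 = 1 := by simp [qfact, qfactx]

section SerreLusztig

variable {A : Type*} [Ring A] [Algebra K A]

/-- The alternating sum `∑_{r+s=m} (-1)^r B^{(r)} W B^{(s)}` of ı-divided powers. -/
def serreSum (B W Z : A) (p : ZMod 2) (m : ℕ) : A :=
  ∑ r ∈ Finset.range (m + 1), ((-1 : K) ^ r) • (iDP B Z p r * W * iDP B Z p (m - r))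

/-- The alternating sum of total degree five is obtained from the one of total degree three by
applying a quadratic polynomial in left and right multiplication by `B`. -/
theorem serreSum_five (B W Z : A) (hZ : ∀ a : A, Z * a = a * Z) (p : ZMod 2) :
    serreSum B W Z p 5 = (qint 4 * qint 5)⁻¹ •
      (B ^ 2 * serreSum B W Z p 3
        - (qint 2 ^ 4 - 4 * qint 2 ^ 2 + 2) • (B * serreSum B W Z p 3 * B)
        + serreSum B W Z p 3 * B ^ 2
        - (qint 4 ^ 2 * qq) • (Z * serreSum B W Z p 3)) := by
  have t2 : qint 2 ≠ 0 := qint_natCast_ne_zero two_ne_zero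
  have t3 : qint 3 ≠ 0 := qint_natCast_ne_zero three_ne_zero
  have t4 : qint 4 ≠ 0 := qint_natCast_ne_zero four_ne_zero
  have t5 : qint 5 ≠ 0 := qint_natCast_ne_zero (n := 5) (by norm_num)
  have hB : B * Z = Z * B := (hZ B).symm
  have hW : W * Z = Z * W := (hZ W).symm
  have hBZ (a : A) : B * (Z * a) = Z * (B * a) := by rw [← mul_assoc, hB, mul_assoc]
  have hWZ (a : A) : W * (Z * a) = Z * (W * a) := by rw [← mul_assoc, hW, mul_assoc]
  have f1 : qfact 1 = 1 := by simp [qfact_succ, qfact_zero, qint_one]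
  have f2 : qfact 2 = qint 2 := by rw [qfact_succ, f1]; norm_num
  have f3 : qfact 3 = qint 2 * qint 3 := by rw [qfact_succ, f2]; norm_num
  have f4 : qfact 4 = qint 2 * qint 3 * qint 4 := by rw [qfact_succ, f3]; norm_num
  have f5 : qfact 5 = qint 2 * qint 3 * qint 4 * qint 5 := by rw [qfact_succ, f4]; norm_num
  have e3 := qint_three
  have e4 := qint_four
  have e5 := qint_five
  have hp : p = 0 ∨ p = 1 := by revert p; decide
  rcases hp with rfl | rfl <;>
  · simp [serreSum, Finset.sum_range_succ, iDP, List.range_succ, qfact_zero, f1, f2, f3, f4, f5,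
      qint_zero, qint_one, pow_succ, mul_sub, sub_mul, mul_add, add_mul, smul_sub, smul_add,
      mul_assoc, hB, hW, hBZ, hWZ]
    -- `match_scalars` needs these instances rather than the ones found through `ℚ[X]`.
    let : Algebra ℕ K := Semiring.toNatAlgebra
    let : Algebra ℤ K := Ring.toIntAlgebra K
    match_scalars <;> field_simp <;> simp only [e3, e4, e5] <;> ring

end SerreLusztig

theorem stmt13 {A : Type*} [Ring A] [Algebra K A] (Bi Bj Z : A)
    (hZ : ∀ a : A, Z * a = a * Z)
    (h1 : Bi ^ 2 * Bj - qint 2 • (Bi * Bj * Bi) + Bj * Bi ^ 2 = qq • (Z * Bj))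
    (h2 : ∀ p : ZMod 2, ∑ r ∈ Finset.range 4,
        ((-1 : K) ^ r) • (iDP Bi Z p r * Bj ^ 2 * iDP Bi Z p (3 - r)) = 0) :
    ∀ p : ZMod 2, ∑ r ∈ Finset.range 6,
        ((-1 : K) ^ r) • (iDP Bi Z p r * Bj ^ 2 * iDP Bi Z p (5 - r)) = 0 := by
  intro p
  have h3 : serreSum Bi (Bj ^ 2) Z p 3 = 0 := h2 p
  have h5 := serreSum_five Bi (Bj ^ 2) Z hZ p
  rw [h3] at h5
  simpa [serreSum] using h5
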